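/- Let φ be a flow on a compact metric space X, F a strict Lyapunov function for φ, and G a compact topological group acting continuously on X such that φ^t(g·x) = g·φ^t(x) for all g ∈ G, t ∈ ℝ, x ∈ X. Let c ∈ ℝ, let K ⊆ fix(φ) ∩ F⁻¹({c}) be a nonempty compact G-invariant set, and let V ⊆ X satisfy Inv(V) = K ⊆ interior(V). Then there exists a compact G-invariant set W ⊆ V with Inv(W) = K ⊆ interior(W) and closure(W₋) ⊆ {x ∈ W : F(x) < c}; that is, V contains an isolating block of K. -/

import Mathlib

open Pointwise

/-- The rest-point set of a flow. -/
def fixedSet {X : Type*} [TopologicalSpace X] (φ : Flow ℝ X) : Set X :=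
  {x | ∀ t : ℝ, φ t x = x}

/-- The maximal invariant subset `Inv(W)` of a set `W`. -/
def invSet {X : Type*} [TopologicalSpace X] (φ : Flow ℝ X) (W : Set X) : Set X :=
  {x ∈ W | ∀ t : ℝ, φ t x ∈ W}

/-- The exit set `W₋` of `W`. -/
def exitSet {X : Type*} [TopologicalSpace X] (φ : Flow ℝ X) (W : Set X) : Set X :=
  {x ∈ W | ∀ t > (0 : ℝ), ∃ s, 0 ≤ s ∧ s < t ∧ φ s x ∉ W}

open Set Filter Topology

/-- The points of `N` at level at least `a` whose forward orbit stays in `N` while its level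
exceeds `a`. -/
def blockAbove {X : Type*} [TopologicalSpace X] (φ : Flow ℝ X) (F : X → ℝ) (N : Set X) (a : ℝ) :
    Set X :=
  {x ∈ N | a ≤ F x ∧ ∀ t : ℝ, 0 ≤ t → a < F (φ t x) → φ t x ∈ N}

section Flow

variable {X : Type*} [TopologicalSpace X] {φ : Flow ℝ X} {F : X → ℝ} {N : Set X} {a c : ℝ}

lemma invSet_mono {V W : Set X} (h : W ⊆ V) : invSet φ W ⊆ invSet φ V :=
  fun _ hx => ⟨h hx.1, fun t => h (hx.2 t)⟩

lemma Flow.continuous_time (φ : Flow ℝ X) (x : X) : Continuous fun t : ℝ => φ t x :=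
  φ.continuous continuous_id continuous_const

lemma Flow.continuous_space (φ : Flow ℝ X) (t : ℝ) : Continuous fun x : X => φ t x :=
  φ.continuous continuous_const continuous_id

lemma isClosed_blockAbove (hF : Continuous F) (hN : IsClosed N) :
    IsClosed (blockAbove φ F N a) := by
  have h : blockAbove φ F N a = N ∩ ({x | a ≤ F x} ∩
      ⋂ (t : ℝ) (_ : 0 ≤ t), ({x | F (φ t x) ≤ a} ∪ (fun x => φ t x) ⁻¹' N)) := by
    ext x
    simp only [blockAbove, mem_ofPred_eq, mem_inter_iff, mem_iInter, mem_union, mem_preimage,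
      ← not_lt, imp_iff_not_or]
  rw [h]
  refine hN.inter ((isClosed_le continuous_const hF).inter
    (isClosed_iInter fun t => isClosed_iInter fun _ => ?_))
  exact (isClosed_le (hF.comp (φ.continuous_space t)) continuous_const).union
    (hN.preimage (φ.continuous_space t))

lemma exitSet_blockAbove_subset (hF : Continuous F) :
    exitSet φ (blockAbove φ F N a) ⊆ {x | F x ≤ a} := by
  rintro x ⟨hx, hexit⟩
  by_contra hlt
  simp only [mem_ofPred_eq, not_le] at hlt
  have hev : ∀ᶠ t : ℝ in 𝓝 0, a < F (φ t x) := by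
    apply (hF.comp (φ.continuous_time x)).continuousAt.eventually_const_lt
    simpa using hlt
  obtain ⟨δ, hδ, hball⟩ := Metric.eventually_nhds_iff.1 hev
  obtain ⟨s, hs0, hsδ, hs⟩ := hexit δ hδ
  have hlev : a < F (φ s x) := hball (by simpa [abs_of_nonneg hs0] using hsδ)
  refine hs ⟨hx.2.2 s hs0 hlev, hlev.le, fun t ht hat => ?_⟩
  rw [← φ.map_add] at hat ⊢
  exact hx.2.2 _ (add_nonneg ht hs0) hat

/-- If a point leaves the interior of a closed set `N` by time `t`, it does so at a first time. -/
lemma exists_first_exit (hN : IsClosed N) {x : X} (hx : x ∈ interior N) {t : ℝ} (ht : 0 ≤ t)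
    (hxt : φ t x ∉ interior N) :
    ∃ s, 0 ≤ s ∧ s ≤ t ∧ φ s x ∉ interior N ∧ ∀ r, 0 ≤ r → r ≤ s → φ r x ∈ N := by
  set S : Set ℝ := {s | 0 ≤ s ∧ φ s x ∉ interior N}
  have hSclosed : IsClosed S :=
    isClosed_Ici.inter ((isOpen_interior.preimage (φ.continuous_time x)).isClosed_compl)
  have hSbdd : BddBelow S := ⟨0, fun s hs => hs.1⟩
  have htS : t ∈ S := ⟨ht, hxt⟩
  have hmem : sInf S ∈ S := hSclosed.csInf_mem ⟨t, htS⟩ hSbdd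
  have hbefore : ∀ r ∈ Ico 0 (sInf S), φ r x ∈ N := by
    intro r hr
    by_contra hrN
    exact (csInf_le hSbdd ⟨hr.1, fun h => hrN (interior_subset h)⟩).not_gt hr.2
  have hpos : 0 ≠ sInf S := by
    intro h
    apply hmem.2
    rw [← h]
    simpa using hx
  refine ⟨sInf S, hmem.1, csInf_le hSbdd htS, hmem.2, fun r hr0 hr => ?_⟩
  have hcl : Icc 0 (sInf S) ⊆ (fun t => φ t x) ⁻¹' N := by
    rw [← closure_Ico hpos]
    exact closure_minimal hbefore (hN.preimage (φ.continuous_time x))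
  exact hcl ⟨hr0, hr⟩

/-- Under a strict Lyapunov function, a point outside `Inv(N)` whose backward orbit stays
in `N` lies below the level of `Inv(N)`. -/
lemma lt_of_backward_mem [CompactSpace X] (hF : Continuous F)
    (hLyap : ∀ (x : X) (t : ℝ), 0 ≤ t → F (φ t x) ≤ F x)
    (hStrict : ∀ (x : X) (t : ℝ), 0 ≤ t → F (φ t x) = F x → φ t x = x)
    (hN : IsClosed N) (hlevel : ∀ x ∈ invSet φ N, F x = c)
    {y : X} (hy : y ∉ invSet φ N) (hback : ∀ t : ℝ, 0 ≤ t → φ (-t) y ∈ N) : F y < c := by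
  obtain ⟨p, hp⟩ := exists_clusterPt_of_compactSpace (map (fun t : ℝ => φ (-t) y) atTop)
  have hcluster : ∀ {C : Set X}, IsClosed C → (∀ᶠ t : ℝ in atTop, φ (-t) y ∈ C) → p ∈ C :=
    fun hC h => isClosed_iff_clusterPt.1 hC p (hp.mono (le_principal_iff.2 h))
  have hpinv : ∀ s : ℝ, φ s p ∈ N := by
    intro s
    refine hcluster (hN.preimage (φ.continuous_space s)) ?_
    filter_upwards [eventually_ge_atTop s] with t ht
    have := hback (t - s) (sub_nonneg.2 ht)
    rw [mem_preimage, ← φ.map_add]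
    convert this using 2
    ring
  have hpc : F p = c := hlevel p ⟨by simpa using hpinv 0, hpinv⟩
  have hle : ∀ t : ℝ, F (φ (-t) y) ≤ c := by
    intro t
    rw [← hpc]
    refine hcluster (C := {x | F (φ (-t) y) ≤ F x}) (isClosed_le continuous_const hF) ?_
    filter_upwards [eventually_ge_atTop t] with s hs
    have := hLyap (φ (-s) y) (s - t) (sub_nonneg.2 hs)
    rw [← φ.map_add] at this
    convert this using 3
    ring
  have hyc : F y ≤ c := by simpa using hle 0
  refine hyc.lt_of_ne fun hEq => hy ?_
  have hfix : ∀ t : ℝ, 0 ≤ t → φ (-t) y = y := by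
    intro t ht
    have hreturn : φ t (φ (-t) y) = y := by rw [← φ.map_add]; simp
    have h1 := hLyap (φ (-t) y) t ht
    have h2 := hStrict (φ (-t) y) t ht
    rw [hreturn] at h1 h2
    exact (h2 (le_antisymm h1 (hEq ▸ hle t))).symm
  have hyN : y ∈ N := by simpa using hback 0 le_rfl
  refine ⟨hyN, fun t => ?_⟩
  rcases le_total 0 t with ht | ht
  · have h := congrArg (φ t) (hfix t ht)
    rw [← φ.map_add] at h
    simp only [add_neg_cancel, φ.map_zero_apply] at h
    rwa [← h]
  · simpa using hback (-t) (neg_nonneg.2 ht)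

/-- Boundary points of `N` whose backward orbit stays in `N` for a sufficiently long time are
uniformly below the level of `Inv(N)`. -/
lemma exists_uniform_drop [CompactSpace X] (hF : Continuous F)
    (hLyap : ∀ (x : X) (t : ℝ), 0 ≤ t → F (φ t x) ≤ F x)
    (hStrict : ∀ (x : X) (t : ℝ), 0 ≤ t → F (φ t x) = F x → φ t x = x)
    (hN : IsClosed N) (hlevel : ∀ x ∈ invSet φ N, F x = c)
    (hint : invSet φ N ⊆ interior N) :
    ∃ a < c, ∃ T : ℝ, ∀ y ∉ interior N, (∀ t : ℝ, 0 ≤ t → t ≤ T → φ (-t) y ∈ N) → F y < a := by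
  let B : ℕ → Set X := fun n => {y | y ∉ interior N ∧
    (∀ t : ℝ, 0 ≤ t → t ≤ n → φ (-t) y ∈ N) ∧ c - 1 / ((n : ℝ) + 1) ≤ F y}
  have hBclosed : ∀ n, IsClosed (B n) := by
    intro n
    refine isOpen_interior.isClosed_compl.inter (IsClosed.inter ?_
      (isClosed_le continuous_const hF))
    have : {y | ∀ t : ℝ, 0 ≤ t → t ≤ n → φ (-t) y ∈ N} =
        ⋂ (t : ℝ) (_ : 0 ≤ t) (_ : t ≤ n), (fun y => φ (-t) y) ⁻¹' N := by
      ext y; simp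
    change IsClosed {y | ∀ t : ℝ, 0 ≤ t → t ≤ n → φ (-t) y ∈ N}
    rw [this]
    exact isClosed_iInter fun t => isClosed_iInter fun _ => isClosed_iInter fun _ =>
      hN.preimage (φ.continuous_space _)
  have hBanti : ∀ n, B (n + 1) ⊆ B n := by
    rintro n y ⟨hy, hback, hFy⟩
    refine ⟨hy, fun t h0 ht => hback t h0 (ht.trans (by simp)), le_trans ?_ hFy⟩
    have := Nat.one_div_le_one_div (α := ℝ) (Nat.le_succ n)
    push_cast at this ⊢
    linarith
  obtain ⟨n, hn⟩ : ∃ n, ¬ (B n).Nonempty := by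
    by_contra! hne
    obtain ⟨y, hy⟩ := IsCompact.nonempty_iInter_of_sequence_nonempty_isCompact_isClosed B hBanti
      hne (hBclosed 0).isCompact hBclosed
    rw [mem_iInter] at hy
    have hlt : F y < c := by
      refine lt_of_backward_mem hF hLyap hStrict hN hlevel (fun h => (hy 0).1 (hint h)) ?_
      intro t ht
      obtain ⟨n, hn⟩ := exists_nat_ge t
      exact (hy n).2.1 t ht hn
    obtain ⟨n, hn⟩ := exists_nat_one_div_lt (sub_pos.2 hlt)
    linarith [(hy n).2.2]
  refine ⟨c - 1 / ((n : ℝ) + 1), sub_lt_self _ (by positivity), n, fun y hy hback => ?_⟩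
  by_contra! h
  exact hn ⟨y, hy, hback, h⟩

/-- For a suitable level `a < c`, the set `blockAbove φ F N a` is a neighborhood of the rest
points `Inv(N)`. -/
lemma exists_invSet_subset_interior_blockAbove [CompactSpace X] (hF : Continuous F)
    (hLyap : ∀ (x : X) (t : ℝ), 0 ≤ t → F (φ t x) ≤ F x)
    (hStrict : ∀ (x : X) (t : ℝ), 0 ≤ t → F (φ t x) = F x → φ t x = x)
    (hN : IsClosed N) (hlevel : ∀ x ∈ invSet φ N, F x = c)
    (hfix : invSet φ N ⊆ fixedSet φ) (hint : invSet φ N ⊆ interior N) :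
    ∃ a < c, invSet φ N ⊆ interior (blockAbove φ F N a) := by
  obtain ⟨a, hac, T, hdrop⟩ := exists_uniform_drop hF hLyap hStrict hN hlevel hint
  refine ⟨a, hac, fun x hx => mem_interior_iff_mem_nhds.2 ?_⟩
  have hstay : ∀ᶠ z in 𝓝 x, ∀ t ∈ Icc 0 T, φ t z ∈ interior N := by
    refine isCompact_Icc.eventually_forall_of_forall_eventually fun t _ => ?_
    have hcont : Continuous fun z : X × ℝ => φ z.2 z.1 :=
      φ.continuous continuous_snd continuous_fst
    refine hcont.continuousAt.eventually_mem (isOpen_interior.mem_nhds ?_)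
    change φ t x ∈ interior N
    rw [hfix hx t]
    exact hint hx
  have hlev : ∀ᶠ z in 𝓝 x, a < F z :=
    hF.continuousAt.eventually_const_lt (by rwa [hlevel x hx])
  filter_upwards [hstay, hlev, isOpen_interior.mem_nhds (hint hx)] with z hz haz hzN
  refine ⟨interior_subset hzN, haz.le, fun t ht hat => ?_⟩
  by_contra htN
  obtain ⟨s, hs0, hst, hs, hbefore⟩ :=
    exists_first_exit hN hzN ht (fun h => htN (interior_subset h))
  have hTs : T < s := by
    by_contra! h
    exact hs (hz s ⟨hs0, h⟩)
  have hlow : F (φ s z) < a := by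
    refine hdrop _ hs fun r hr0 hrT => ?_
    rw [← φ.map_add]
    exact hbefore _ (by linarith) (by linarith)
  have hmono := hLyap (φ s z) (t - s) (sub_nonneg.2 hst)
  rw [← φ.map_add, sub_add_cancel] at hmono
  linarith

end Flow

section Action

variable {X G : Type*} [Group G] [MulAction G X]

lemma smul_set_eq_of_forall_mem {W : Set X} (h : ∀ (g : G), ∀ x ∈ W, g • x ∈ W) (g : G) :
    g • W = W := by
  refine Subset.antisymm ?_ fun x hx => ?_
  · rintro _ ⟨x, hx, rfl⟩
    exact h g x hx
  · exact mem_smul_set_iff_inv_smul_mem.2 (h g⁻¹ x hx)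

lemma smul_mem_blockAbove [TopologicalSpace X] {φ : Flow ℝ X} {F : X → ℝ} {N : Set X} {a : ℝ}
    (hequiv : ∀ (g : G) (t : ℝ) (x : X), φ t (g • x) = g • φ t x)
    (hFG : ∀ (g : G) (x : X), F (g • x) = F x) (hN : ∀ (g : G), ∀ x ∈ N, g • x ∈ N)
    (g : G) (x : X) (hx : x ∈ blockAbove φ F N a) : g • x ∈ blockAbove φ F N a := by
  refine ⟨hN g x hx.1, by rw [hFG]; exact hx.2.1, fun t ht hat => ?_⟩
  rw [hequiv, hFG] at hat
  rw [hequiv]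
  exact hN g _ (hx.2.2 t ht hat)

end Action

section Equivariant

variable {X G : Type*} [TopologicalSpace X] [TopologicalSpace G] [Group G] [CompactSpace G]
  [MulAction G X] [ContinuousSMul G X]

/-- An invariant set with a closed neighborhood has an invariant closed neighborhood inside it. -/
lemma exists_invariant_closed_nhds {K C : Set X} (hC : IsClosed C) (hKC : K ⊆ interior C)
    (hK : ∀ (g : G), ∀ x ∈ K, g • x ∈ K) :
    ∃ N ⊆ C, IsClosed N ∧ K ⊆ interior N ∧ ∀ (g : G), ∀ x ∈ N, g • x ∈ N := by
  refine ⟨{x | ∀ g : G, g • x ∈ C}, fun x hx => by simpa using hx 1, ?_, fun x hx => ?_,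
    fun g x hx h => by simpa [mul_smul] using hx (h * g)⟩
  · rw [ofPred_forall]
    exact isClosed_iInter fun g => hC.preimage (continuous_const_smul g)
  · rw [mem_interior_iff_mem_nhds]
    have h : ∀ᶠ z in 𝓝 x, ∀ g ∈ (univ : Set G), g • z ∈ C := by
      refine isCompact_univ.eventually_forall_of_forall_eventually fun g _ => ?_
      have hcont : Continuous fun z : X × G => z.2 • z.1 := by fun_prop
      exact hcont.continuousAt.eventually_mem
        (mem_interior_iff_mem_nhds.1 (hKC (hK g x hx)))
    filter_upwards [h] with z hz g using hz g (mem_univ g)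

variable (G) in
/-- The maximum of a function over group orbits. -/
noncomputable def orbitSup (F : X → ℝ) (x : X) : ℝ := sSup ((fun g : G => F (g • x)) '' univ)

variable {F : X → ℝ}

lemma continuous_orbitSup (hF : Continuous F) : Continuous (orbitSup G F) := by
  refine isCompact_univ.continuous_sSup (f := fun (x : X) (g : G) => F (g • x)) ?_
  exact hF.comp (continuous_snd.smul continuous_fst)

lemma le_orbitSup (hF : Continuous F) (x : X) (g : G) : F (g • x) ≤ orbitSup G F x :=
  le_csSup (isCompact_univ.image (by fun_prop)).bddAbove ⟨g, mem_univ g, rfl⟩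

lemma exists_eq_orbitSup (hF : Continuous F) (x : X) : ∃ g : G, F (g • x) = orbitSup G F x := by
  have hcomp : IsCompact ((fun g : G => F (g • x)) '' univ) :=
    isCompact_univ.image (by fun_prop)
  obtain ⟨g, -, hg⟩ := hcomp.sSup_mem (univ_nonempty.image _)
  exact ⟨g, hg⟩

lemma orbitSup_smul_le (hF : Continuous F) (g : G) (x : X) :
    orbitSup G F x ≤ orbitSup G F (g • x) := by
  obtain ⟨h, hh⟩ := exists_eq_orbitSup (G := G) hF x
  have := le_orbitSup hF (g • x) (h * g⁻¹)
  rwa [mul_smul, inv_smul_smul, hh] at this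

lemma orbitSup_smul (hF : Continuous F) (g : G) (x : X) :
    orbitSup G F (g • x) = orbitSup G F x := by
  refine le_antisymm ?_ (orbitSup_smul_le hF g x)
  simpa using orbitSup_smul_le hF g⁻¹ (g • x)

variable {φ : Flow ℝ X}

lemma orbitSup_flow_le (hF : Continuous F)
    (hLyap : ∀ (x : X) (t : ℝ), 0 ≤ t → F (φ t x) ≤ F x)
    (hequiv : ∀ (g : G) (t : ℝ) (x : X), φ t (g • x) = g • φ t x) (x : X) (t : ℝ) (ht : 0 ≤ t) :
    orbitSup G F (φ t x) ≤ orbitSup G F x := by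
  obtain ⟨g, hg⟩ := exists_eq_orbitSup (G := G) hF (φ t x)
  rw [← hg, ← hequiv]
  exact (hLyap _ t ht).trans (le_orbitSup hF x g)

lemma flow_eq_of_orbitSup_eq (hF : Continuous F)
    (hLyap : ∀ (x : X) (t : ℝ), 0 ≤ t → F (φ t x) ≤ F x)
    (hStrict : ∀ (x : X) (t : ℝ), 0 ≤ t → F (φ t x) = F x → φ t x = x)
    (hequiv : ∀ (g : G) (t : ℝ) (x : X), φ t (g • x) = g • φ t x) (x : X) (t : ℝ) (ht : 0 ≤ t)
    (heq : orbitSup G F (φ t x) = orbitSup G F x) : φ t x = x := by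
  obtain ⟨g, hg⟩ := exists_eq_orbitSup (G := G) hF (φ t x)
  rw [← hequiv] at hg
  have hge : F (g • x) ≤ F (φ t (g • x)) := by
    rw [hg, heq]
    exact le_orbitSup hF x g
  have hfix := hStrict _ t ht (le_antisymm (hLyap _ t ht) hge)
  rw [hequiv] at hfix
  exact smul_left_cancel g hfix

end Equivariant

/-- Existence of an isolating block: if `K ⊆ fix(φ) ∩ F⁻¹({c})` is a nonempty compact
`G`-invariant isolated invariant set with isolating neighborhood `V`, then `V` contains
a `G`-invariant isolating block `W` of `K`. -/
theorem exists_isolating_block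
    {X : Type*} [MetricSpace X] [CompactSpace X]
    {G : Type*} [TopologicalSpace G] [Group G] [IsTopologicalGroup G] [CompactSpace G]
    [MulAction G X] [ContinuousSMul G X]
    (φ : Flow ℝ X) (F : X → ℝ) (hF : Continuous F)
    (hLyap : ∀ (x : X) (t : ℝ), 0 ≤ t → F (φ t x) ≤ F x)
    (hStrict : ∀ (x : X) (t : ℝ), 0 ≤ t → (F (φ t x) = F x ↔ φ t x = x))
    (hequiv : ∀ (g : G) (t : ℝ) (x : X), φ t (g • x) = g • φ t x)
    (c : ℝ) (K : Set X)
    (hKne : K.Nonempty) (hKcomp : IsCompact K)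
    (hKfix : K ⊆ fixedSet φ) (hKlevel : K ⊆ F ⁻¹' {c})
    (hKG : ∀ g : G, g • K = K)
    (V : Set X) (hVinv : invSet φ V = K) (hVint : K ⊆ interior V) :
    ∃ W : Set X, W ⊆ V ∧ IsCompact W ∧ (∀ g : G, g • W = W) ∧
      invSet φ W = K ∧ K ⊆ interior W ∧
      closure (exitSet φ W) ⊆ {x ∈ W | F x < c} := by
  have hStrict' : ∀ (x : X) (t : ℝ), 0 ≤ t → F (φ t x) = F x → φ t x = x :=
    fun x t ht => (hStrict x t ht).1
  have hKsmul : ∀ (g : G), ∀ x ∈ K, g • x ∈ K := fun g x hx => by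
    rw [← hKG g]
    exact Set.smul_mem_smul_set hx
  obtain ⟨C, hCcomp, hKC, hCV⟩ := exists_compact_between hKcomp isOpen_interior hVint
  obtain ⟨N, hNC, hN, hKN, hNG⟩ := exists_invariant_closed_nhds hCcomp.isClosed hKC hKsmul
  have hNV : N ⊆ V := hNC.trans (hCV.trans interior_subset)
  have hK_subset : ∀ {W : Set X}, K ⊆ W → K ⊆ invSet φ W := fun h x hx =>
    ⟨h hx, fun t => by rw [hKfix hx t]; exact h hx⟩
  have hNinv : invSet φ N = K :=
    ((invSet_mono hNV).trans hVinv.subset).antisymm (hK_subset (hKN.trans interior_subset))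
  have hlevel : ∀ x ∈ invSet φ N, orbitSup G F x = c := by
    intro x hx
    obtain ⟨g, hg⟩ := exists_eq_orbitSup (G := G) hF x
    rw [← hg]
    exact hKlevel (hKsmul g x (hNinv ▸ hx))
  have hSup : Continuous (orbitSup G F) := continuous_orbitSup hF
  obtain ⟨a, hac, hint⟩ := exists_invSet_subset_interior_blockAbove hSup
    (orbitSup_flow_le hF hLyap hequiv) (flow_eq_of_orbitSup_eq hF hLyap hStrict' hequiv)
    hN hlevel (hNinv ▸ hKfix) (hNinv ▸ hKN)
  rw [hNinv] at hint
  have hclosed : IsClosed (blockAbove φ (orbitSup G F) N a) := isClosed_blockAbove hSup hN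
  have hWV : blockAbove φ (orbitSup G F) N a ⊆ V := fun x hx => hNV hx.1
  refine ⟨blockAbove φ (orbitSup G F) N a, hWV, hclosed.isCompact,
    smul_set_eq_of_forall_mem (smul_mem_blockAbove hequiv (orbitSup_smul hF) hNG),
    ((invSet_mono hWV).trans hVinv.subset).antisymm (hK_subset (hint.trans interior_subset)),
    hint, fun x hx => ⟨closure_minimal (fun y hy => hy.1) hclosed hx, ?_⟩⟩
  have hle : orbitSup G F x ≤ a := closure_minimal (exitSet_blockAbove_subset hSup)
    (isClosed_le hSup continuous_const) hx
  have hFx : F x ≤ orbitSup G F x := by simpa using le_orbitSup hF x (1 : G)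
  linarith
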